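/- arXiv:2107.01468 — 2 statements merged into one kernel-verified Lean document; each statement's English description precedes it below -/
import Mathlib

section
/- n-equivalence is a congruence for generalized concatenation: let α be a linear order and for each i : α let wᵢ : β i → Σ and w'ᵢ : β' i → Σ be words with wᵢ ∼ₙ w'ᵢ for every i. Then the generalized concatenations ∏_{i∈α} wᵢ and ∏_{i∈α} w'ᵢ are n-equivalent. -/
/-- A finite word `s : List A` is a subword of a word `w : α → A` over a linear order `α`
if there is a strictly monotone map `g` from `Fin s.length` to `α` picking out `s`. -/
def IsSubword {A : Type*} {α : Type*} [LinearOrder α] (s : List A) (w : α → A) : Prop :=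
  ∃ g : Fin s.length → α, StrictMono g ∧ ∀ i, w (g i) = s.get i

/-- Two words (over possibly different linear orders) are `n`-equivalent if they have
exactly the same subwords of length at most `n`. -/
def NEquiv {A : Type*} (n : ℕ) {α : Type*} {β : Type*} [LinearOrder α] [LinearOrder β]
    (u : α → A) (v : β → A) : Prop :=
  ∀ s : List A, s.length ≤ n → (IsSubword s u ↔ IsSubword s v)

/-- Generalized concatenation of the family of words `w i : β i → A` over the index
linear order `α`: the word on the lexicographic sigma order sending `⟨i, x⟩` to `w i x`. -/
def genConcat {A : Type*} {α : Type*} {β : α → Type*} (w : ∀ i, β i → A) :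
    Lex (Σ i, β i) → A :=
  fun x => w (ofLex x).1 (ofLex x).2

/-- A subword embedding indexed by any finite linear order of size at most `n` can be
transported along `n`-equivalence. -/
theorem NEquiv.exists_strictMono {A α β ι : Type*} [LinearOrder α] [LinearOrder β]
    [LinearOrder ι] [Fintype ι] {n : ℕ} {u : α → A} {v : β → A} (h : NEquiv n u v)
    (hι : Fintype.card ι ≤ n) {f : ι → α} (hf : StrictMono f) :
    ∃ f' : ι → β, StrictMono f' ∧ ∀ k, v (f' k) = u (f k) := by
  let s : List A := List.ofFn fun k => u (f (Fintype.orderIsoFinOfCardEq ι rfl k))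
  have hs : s.length = Fintype.card ι := List.length_ofFn
  let e : Fin s.length ≃o ι := (Fin.castOrderIso hs).trans (Fintype.orderIsoFinOfCardEq ι rfl)
  have he : ∀ i, u (f (e i)) = s.get i := fun i => by
    simp [s, e]
    rfl
  obtain ⟨g, hg, hgs⟩ := (h s (hs.trans_le hι)).1 ⟨f ∘ e, hf.comp e.strictMono, he⟩
  exact ⟨g ∘ e.symm, hg.comp e.symm.strictMono, fun k => by
    rw [Function.comp_apply, hgs, ← he, OrderIso.apply_symm_apply]⟩

theorem NEquiv.symm {A α β : Type*} [LinearOrder α] [LinearOrder β] {n : ℕ}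
    {u : α → A} {v : β → A} (h : NEquiv n u v) : NEquiv n v u :=
  fun s hs => (h s hs).symm

theorem Sigma.Lex.toLex_mk_lt_toLex_mk {α : Type*} {β : α → Type*} [LinearOrder α]
    [∀ i, LinearOrder (β i)] {i : α} {a b : β i} :
    (toLex ⟨i, a⟩ : Σₗ i, β i) < toLex ⟨i, b⟩ ↔ a < b := by
  rw [Sigma.Lex.lt_def]
  change (i < i ∨ ∃ h : i = i, h ▸ a < b) ↔ a < b
  simp

/-- Replacing each factor by an `n`-equivalent one preserves subwords of length at most `n`. -/
theorem IsSubword.genConcat_of_nequiv {A α : Type*} [LinearOrder α] {β β' : α → Type*}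
    [∀ i, LinearOrder (β i)] [∀ i, LinearOrder (β' i)] {n : ℕ}
    {w : ∀ i, β i → A} {w' : ∀ i, β' i → A} (h : ∀ i, NEquiv n (w i) (w' i))
    {s : List A} (hn : s.length ≤ n) (hs : IsSubword s (genConcat w)) :
    IsSubword s (genConcat w') := by
  obtain ⟨g, hg, hgs⟩ := hs
  have hG : ∀ i (k : {k // (ofLex (g k)).1 = i}), ∃ b : β i, toLex ⟨i, b⟩ = g k := by
    rintro _ ⟨k, rfl⟩
    exact ⟨(ofLex (g k)).2, rfl⟩
  choose G hG using hG
  have hGmono : ∀ i, StrictMono (G i) := fun i k l hkl => by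
    rw [← Sigma.Lex.toLex_mk_lt_toLex_mk, hG, hG]
    exact hg hkl
  have hcard : ∀ i, Fintype.card {k // (ofLex (g k)).1 = i} ≤ n := fun i =>
    (Fintype.card_subtype_le _).trans (by simpa using hn)
  choose F hF hFG using fun i => (h i).exists_strictMono (hcard i) (hGmono i)
  have hcongr : ∀ i k (hk : (ofLex (g k)).1 = i),
      (toLex ⟨_, F _ ⟨k, rfl⟩⟩ : Σₗ i, β' i) = toLex ⟨i, F i ⟨k, hk⟩⟩ := by
    rintro _ k rfl
    rfl
  refine ⟨fun k => toLex ⟨_, F _ ⟨k, rfl⟩⟩, fun k l hkl => ?_, fun k => ?_⟩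
  · rcases Sigma.Lex.lt_def.1 (hg hkl) with hlt | ⟨heq, -⟩
    · exact Sigma.Lex.lt_def.2 (Or.inl hlt)
    · change (toLex ⟨_, F _ ⟨k, rfl⟩⟩ : Σₗ i, β' i) < toLex ⟨_, F _ ⟨l, rfl⟩⟩
      rw [hcongr (ofLex (g l)).1 k heq, Sigma.Lex.toLex_mk_lt_toLex_mk]
      exact hF _ hkl
  · rw [← hgs k]
    refine (hFG _ ⟨k, rfl⟩).trans ?_
    exact congrArg (genConcat w) (hG _ ⟨k, rfl⟩)

/-- `n`-equivalence is a congruence for generalized concatenation. -/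
theorem nequiv_genConcat {A : Type*} [Finite A] [Nonempty A] (n : ℕ)
    {α : Type*} [LinearOrder α] {β β' : α → Type*}
    [∀ i, LinearOrder (β i)] [∀ i, LinearOrder (β' i)]
    (w : ∀ i, β i → A) (w' : ∀ i, β' i → A)
    (h : ∀ i, NEquiv n (w i) (w' i)) :
    NEquiv n (genConcat w) (genConcat w') :=
  fun _ hs => ⟨.genConcat_of_nequiv h hs, .genConcat_of_nequiv (fun i => (h i).symm) hs⟩
end

section
/- The rational order has infinite infinitary rank: for every n : ℕ, the linear order ℚ is not order-isomorphic to any member of the class Iₙ. -/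
/-- `γ` is (isomorphic to) a generalized sum `Σ_{i ∈ ℤ} β i` in which every summand is
either empty or satisfies the predicate `P`, and not all summands are empty. -/
def IsZSum (P : ∀ (α : Type) [LinearOrder α], Prop) (γ : Type) [LinearOrder γ] : Prop :=
  ∃ (β : ℤ → Type) (_ : ∀ i, LinearOrder (β i)),
    (∀ i, IsEmpty (β i) ∨ P (β i)) ∧ (∃ i, Nonempty (β i)) ∧
      Nonempty (γ ≃o Lex (Σ i, β i))

/-- Membership in the class `Iₙ` (closed under order isomorphism): `I₀` is the class of
nonempty finite linear orders; `I_{n+1}` consists of the finite sums of generalized sums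
`Σ_{i ∈ ℤ} β i` whose summands are empty or in `Iₙ`, not all empty. -/
def MemI : ℕ → ∀ (γ : Type) [LinearOrder γ], Prop
  | 0, γ, _ => Finite γ ∧ Nonempty γ
  | n + 1, γ, _ =>
      ∃ k : ℕ, 0 < k ∧ ∃ (δ : Fin k → Type) (_ : ∀ j, LinearOrder (δ j)),
        (∀ j, IsZSum (MemI n) (δ j)) ∧ Nonempty (γ ≃o Lex (Σ j, δ j))

/-- A locally finite order contains no copy of `ℚ`. -/
theorem isEmpty_rat_orderEmbedding_of_locallyFinite {ι : Type*} [LinearOrder ι]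
    [LocallyFiniteOrder ι] : IsEmpty (ℚ ↪o ι) := by
  refine ⟨fun f => (Set.Icc_infinite (zero_lt_one' ℚ)) ?_⟩
  refine Set.Finite.of_finite_image (f := f)
    ((Set.finite_Icc (f 0) (f 1)).subset ?_) f.injective.injOn
  rintro _ ⟨x, hx, rfl⟩
  exact ⟨f.monotone hx.1, f.monotone hx.2⟩

/-- A lexicographic sum, along a scattered order, of scattered orders is scattered. -/
theorem isEmpty_rat_orderEmbedding_sigmaLex {ι : Type*} [LinearOrder ι] {β : ι → Type*}
    [∀ i, LinearOrder (β i)] (hι : IsEmpty (ℚ ↪o ι)) (hβ : ∀ i, IsEmpty (ℚ ↪o β i)) :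
    IsEmpty (ℚ ↪o Lex (Σ i, β i)) := by
  refine ⟨fun f => ?_⟩
  have hmono : Monotone fun q => (ofLex (f q)).1 := fun a b hab => by
    rcases Sigma.Lex.le_def.1 (f.monotone hab) with h | ⟨h, -⟩
    exacts [h.le, h.le]
  by_cases hinj : Function.Injective fun q => (ofLex (f q)).1
  · exact hι.false (OrderEmbedding.ofStrictMono _ (hmono.strictMono_of_injective hinj))
  simp only [Function.Injective, not_forall] at hinj
  obtain ⟨a, b, hab, hne⟩ := hinj
  wlog hlt : a < b generalizing a b
  · exact this b a hab.symm (Ne.symm hne) (lt_of_le_of_ne (not_lt.1 hlt) (Ne.symm hne))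
  have : Nontrivial (Set.Ioo a b) := (Set.Ioo_infinite hlt).nontrivial.coe_sort
  obtain ⟨e⟩ := Order.embedding_from_countable_to_dense ℚ (Set.Ioo a b)
  have hfst : ∀ q, ∃ y : β (ofLex (f a)).1, f (e q) = toLex ⟨(ofLex (f a)).1, y⟩ := fun q => by
    have h : (ofLex (f (e q))).1 = (ofLex (f a)).1 :=
      ((hmono (e q).2.2.le).trans hab.ge).antisymm (hmono (e q).2.1.le)
    rw [← h]
    exact ⟨_, rfl⟩
  choose g hg using hfst
  refine (hβ _).false (OrderEmbedding.ofStrictMono g fun p q hpq => ?_)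
  have h : f (e p) < f (e q) := f.strictMono (e.strictMono hpq)
  rw [hg, hg] at h
  rcases Sigma.Lex.lt_def.1 h with h | ⟨_, h⟩
  exacts [absurd h (lt_irrefl _), h]

/-- Every order of finite infinitary rank is scattered. -/
theorem MemI.isEmpty_rat_orderEmbedding (n : ℕ) (γ : Type) [LinearOrder γ] (h : MemI n γ) :
    IsEmpty (ℚ ↪o γ) := by
  induction n generalizing γ with
  | zero =>
    have := h.1
    exact ⟨fun f => not_finite_iff_infinite.2 inferInstance (Finite.of_injective f f.injective)⟩
  | succ n ih =>
    obtain ⟨k, -, δ, _, hδ, ⟨e⟩⟩ := h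
    have hscat : IsEmpty (ℚ ↪o Lex (Σ j, δ j)) := by
      refine isEmpty_rat_orderEmbedding_sigmaLex
        isEmpty_rat_orderEmbedding_of_locallyFinite fun j => ?_
      obtain ⟨β, _, hβ, -, ⟨e'⟩⟩ := hδ j
      have hsum : IsEmpty (ℚ ↪o Lex (Σ i, β i)) :=
        isEmpty_rat_orderEmbedding_sigmaLex isEmpty_rat_orderEmbedding_of_locallyFinite fun i =>
          (hβ i).elim (fun _ => ⟨fun f => isEmptyElim (f 0)⟩) (ih (β i))
      exact ⟨fun f => hsum.false (f.trans e'.toOrderEmbedding)⟩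
    exact ⟨fun f => hscat.false (f.trans e.toOrderEmbedding)⟩

/-- The rational order has infinite infinitary rank: for every `n`, `ℚ` is not
order-isomorphic to any member of `Iₙ`. -/
theorem rat_not_memI (n : ℕ) :
    ¬ ∃ (γ : Type) (_ : LinearOrder γ), MemI n γ ∧ Nonempty (ℚ ≃o γ) := by
  rintro ⟨γ, _, hγ, ⟨e⟩⟩
  exact (hγ.isEmpty_rat_orderEmbedding n γ).false e.toOrderEmbedding
end
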